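/- arXiv:2409.11312 — 2 statements merged into one kernel-verified Lean document; each statement's English description precedes it below -/
import Mathlib

section
/- There exist vectors t̃_j, t^x_m, t^z_m ∈ F₂ⁿ for j, m ∈ {1,…,k_d−k_c} and s^x_l, s^z_l ∈ F₂ⁿ for l ∈ {1,…,2k_c−n} with the following properties, where q'_m := q_m + Σ_l (q_m·s^x_l) s^z_l = q_m + Σ_l (q_m·s^z_l) s^x_l: (1) span{s^x_l} = span{s^z_l} = span{p_l : 1≤l≤2k_c−n}, span{t̃_j} = span{p̃_j : 1≤j≤k_d−k_c}, and span({t̃_j}∪{t^x_m}) = span({t̃_j}∪{t^z_m}) = span({p̃_j : j≤k_d−k_c}∪{q'_m}); (2) C^⊥ = span({q̃_i}∪{t̃_j}), C = span({q̃_i}∪{t̃_j}∪{s^x_l}) = span({q̃_i}∪{t̃_j}∪{s^z_l}), and D = span({q̃_i}∪{t̃_j}∪{s^x_l}∪{t^x_m}) = span({q̃_i}∪{t̃_j}∪{s^z_l}∪{t^z_m}); (3) q̃_i·q̃_{i'} = q̃_i·t̃_j = q̃_i·s^x_l = q̃_i·s^z_l = q̃_i·t^x_m = q̃_i·t^z_m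 = 0 for all i,i',j,l,m; (4) t̃_j·t̃_{j'} = t̃_j·s^x_l = t̃_j·s^z_l = 0 for all j,j',l; (5) s^x_l·s^z_l = 1 for each l, and s^x_l·s^z_{l'} = s^z_l·s^x_{l'} = 0 for l ≠ l'; (6) t̃_j·t^x_j = t̃_j·t^z_j = 1 for each j, and t̃_j·t^x_{j'} = t̃_j·t^z_{j'} = 0 for j' ≠ j; (7) s^x_l·t^z_j = s^z_l·t^x_j = 0 for all j,l; (8) t^x_j·t^z_{j'} = 0 for all j,j'. -/
open Polynomial

abbrev F2 := ZMod 2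

abbrev Vec (n : ℕ) := ZMod n → F2

/-- Standard dot product on `F₂`-vectors indexed by a finite type. -/
def dot {ι : Type} [Fintype ι] (u v : ι → F2) : F2 := ∑ i, u i * v i

/-- Right cyclic shift by `α` positions (indices mod `n`). -/
def shiftR {n : ℕ} (c : Vec n) (α : ℤ) : Vec n := fun i => c (i - (α : ZMod n))

/-- Vectorization of a polynomial: `c₀+c₁x+⋯ ↦ (c₀,c₁,…,c_{n-1})`. -/
def polyVec {n : ℕ} (f : Polynomial F2) : Vec n := fun i => f.coeff i.val

/-- A binary cyclic code: a subspace of `F₂ⁿ` closed under cyclic shift. -/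
def IsCyclicCode {n : ℕ} (C : Submodule F2 (Vec n)) : Prop :=
  ∀ c ∈ C, shiftR c 1 ∈ C

/-- Dual code with respect to the standard dot product. -/
def dualCode {ι : Type} [Fintype ι] (C : Submodule F2 (ι → F2)) :
    Submodule F2 (ι → F2) where
  carrier := {w | ∀ c ∈ C, dot c w = 0}
  add_mem' := by
    intro a b ha hb c hc
    have h1 := ha c hc
    have h2 := hb c hc
    simp only [dot, Set.mem_setOf_eq, Pi.add_apply, mul_add, Finset.sum_add_distrib] at *
    rw [h1, h2, add_zero]
  zero_mem' := by
    intro c hc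
    simp [dot]
  smul_mem' := by
    intro r a ha c hc
    have h := ha c hc
    simp only [dot, Set.mem_setOf_eq, Pi.smul_apply, smul_eq_mul] at *
    calc (∑ i, c i * (r * a i)) = r * ∑ i, c i * a i := by
          rw [Finset.mul_sum]
          exact Finset.sum_congr rfl fun i _ => by ring
      _ = 0 := by rw [h, mul_zero]

/-- `g` is the generator polynomial of the cyclic code `C`: monic, divides `xⁿ−1`,
and `C` consists exactly of the vectorizations of the multiples `f·g` with
`deg f < n − deg g`. -/
structure IsGenPoly {n : ℕ} [NeZero n] (C : Submodule F2 (Vec n)) (g : Polynomial F2) :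
    Prop where
  monic : g.Monic
  dvd : g ∣ (X ^ n - 1)
  mem_iff : ∀ v : Vec n, v ∈ C ↔
    ∃ f : Polynomial F2, f.degree < ((n - g.natDegree : ℕ) : WithBot ℕ) ∧ v = polyVec (f * g)

section PolynomialVectors

variable {n : ℕ}

lemma polyVec_add (f g : F2[X]) : (polyVec (f + g) : Vec n) = polyVec f + polyVec g := by
  ext i; simp [polyVec]

lemma polyVec_injective_of_degree_lt [NeZero n] {f g : F2[X]} (hf : f.degree < n)
    (hg : g.degree < n) (h : (polyVec f : Vec n) = polyVec g) : f = g := by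
  ext k
  by_cases hk : k < n
  · simpa [polyVec, ZMod.val_natCast_of_lt hk] using congrFun h (k : ZMod n)
  · have hk' : ((n : ℕ) : WithBot ℕ) ≤ (k : ℕ) := by exact_mod_cast not_lt.mp hk
    rw [coeff_eq_zero_of_degree_lt (hf.trans_le hk'), coeff_eq_zero_of_degree_lt (hg.trans_le hk')]

lemma shiftR_polyVec [NeZero n] (g : F2[X]) {i : ℕ} (hi : i + g.natDegree < n) :
    shiftR (polyVec g : Vec n) (i : ℤ) = polyVec (X ^ i * g) := by
  ext k
  have hival : ((i : ZMod n)).val = i := ZMod.val_natCast_of_lt (by omega)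
  simp only [shiftR, polyVec, coeff_X_pow_mul', Int.cast_natCast]
  split_ifs with hik
  · rw [ZMod.val_sub (by rwa [hival]), hival]
  · apply coeff_eq_zero_of_natDegree_lt
    by_contra! hle
    have hval : k.val = (k - (i : ZMod n)).val + i := by
      conv_lhs => rw [← sub_add_cancel k (i : ZMod n)]
      rw [ZMod.val_add_of_lt (by rw [hival]; omega), hival]
    omega

lemma sum_smul_shiftR_polyVec [NeZero n] (g : F2[X]) {r : ℕ} (hr : r + g.natDegree ≤ n)
    (a : Fin r → F2) :
    ∑ l, a l • shiftR (polyVec g : Vec n) ((l : ℕ) : ℤ)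
      = polyVec (((degreeLTEquiv F2 r).symm a : F2[X]) * g) := by
  have hsymm : ((degreeLTEquiv F2 r).symm a : F2[X]) = ∑ l : Fin r, monomial (l : ℕ) (a l) := rfl
  have hshift : ∀ l : Fin r, shiftR (polyVec g : Vec n) ((l : ℕ) : ℤ) = polyVec (X ^ (l : ℕ) * g) :=
    fun l => shiftR_polyVec g (by omega)
  ext k
  simp only [hshift, hsymm, polyVec, Finset.sum_apply, Pi.smul_apply, Finset.sum_mul,
    finsetSum_coeff, smul_eq_mul]
  refine Finset.sum_congr rfl fun l _ => ?_
  rw [← C_mul_X_pow_eq_monomial, mul_assoc, coeff_C_mul]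

lemma mem_span_shiftR_polyVec_iff [NeZero n] (g : F2[X]) {r : ℕ} (hr : r + g.natDegree ≤ n)
    (v : Vec n) :
    v ∈ Submodule.span F2 (Set.range fun l : Fin r => shiftR (polyVec g : Vec n) ((l : ℕ) : ℤ)) ↔
      ∃ f : F2[X], f.degree < r ∧ v = polyVec (f * g) := by
  rw [Submodule.mem_span_range_iff_exists_fun]
  constructor
  · rintro ⟨a, rfl⟩
    exact ⟨_, mem_degreeLT.mp ((degreeLTEquiv F2 r).symm a).2, sum_smul_shiftR_polyVec g hr a⟩
  · rintro ⟨f, hf, rfl⟩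
    refine ⟨degreeLTEquiv F2 r ⟨f, mem_degreeLT.mpr hf⟩, ?_⟩
    rw [sum_smul_shiftR_polyVec g hr, LinearEquiv.symm_apply_apply]

end PolynomialVectors

namespace IsGenPoly

variable {n : ℕ} [NeZero n] {A B : Submodule F2 (Vec n)} {a b : F2[X]}

lemma natDegree_le (ha : IsGenPoly A a) : a.natDegree ≤ n := by
  have hX : (X ^ n - 1 : F2[X]).Monic := monic_X_pow_sub_C 1 (NeZero.ne n)
  have hdeg : (X ^ n - 1 : F2[X]).natDegree = n := natDegree_X_pow_sub_C (r := (1 : F2))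
  exact (natDegree_le_of_dvd ha.dvd hX.ne_zero).trans_eq hdeg

lemma eq_span (ha : IsGenPoly A a) :
    A = Submodule.span F2
      (Set.range fun l : Fin (n - a.natDegree) => shiftR (polyVec a : Vec n) ((l : ℕ) : ℤ)) := by
  ext v
  rw [mem_span_shiftR_polyVec_iff a (by have := ha.natDegree_le; omega), ha.mem_iff]

lemma degree_mul_lt (ha : IsGenPoly A a) {f : F2[X]} {r : ℕ} (hf : f.degree < r) :
    (f * a).degree < ((r + a.natDegree : ℕ) : WithBot ℕ) := by
  by_cases h0 : f = 0
  · subst h0; simp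
  · rw [degree_eq_natDegree h0] at hf
    rw [degree_mul, degree_eq_natDegree h0, degree_eq_natDegree ha.monic.ne_zero]
    norm_cast at hf ⊢
    omega

lemma dvd_of_le (ha : IsGenPoly A a) (hb : IsGenPoly B b) (hAB : A ≤ B) : b ∣ a := by
  have hX : (X ^ n - 1 : F2[X]).Monic := monic_X_pow_sub_C 1 (NeZero.ne n)
  have hdeg : (X ^ n - 1 : F2[X]).natDegree = n := natDegree_X_pow_sub_C (r := (1 : F2))
  rcases ha.natDegree_le.lt_or_eq with hlt | heq
  · have hmem : (polyVec a : Vec n) ∈ A := by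
      refine (ha.mem_iff _).mpr ⟨1, ?_, by rw [one_mul]⟩
      rw [degree_one]
      exact_mod_cast Nat.sub_pos_of_lt hlt
    obtain ⟨f, hf, hfb⟩ := (hb.mem_iff _).mp (hAB hmem)
    have hfdeg := hb.degree_mul_lt hf
    rw [Nat.sub_add_cancel hb.natDegree_le] at hfdeg
    have hadeg : a.degree < n := by
      rw [degree_eq_natDegree ha.monic.ne_zero]; exact_mod_cast hlt
    rw [polyVec_injective_of_degree_lt hadeg hfdeg hfb]
    exact dvd_mul_left _ _
  · rw [← eq_of_monic_of_dvd_of_natDegree_le ha.monic hX ha.dvd (by rw [hdeg, heq])]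
    exact hb.dvd

lemma natDegree_le_of_le (ha : IsGenPoly A a) (hb : IsGenPoly B b) (hAB : A ≤ B) :
    b.natDegree ≤ a.natDegree :=
  natDegree_le_of_dvd (ha.dvd_of_le hb hAB) ha.monic.ne_zero

/-- If `A ≤ B`, the first `deg a - deg b` shifts of the generator of `B` span a complement of `A`
in `B`. -/
lemma eq_sup_span (ha : IsGenPoly A a) (hb : IsGenPoly B b) (hAB : A ≤ B) {r : ℕ}
    (hr : r + b.natDegree = a.natDegree) :
    B = A ⊔ Submodule.span F2
      (Set.range fun l : Fin r => shiftR (polyVec b : Vec n) ((l : ℕ) : ℤ)) := by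
  have han := ha.natDegree_le
  apply le_antisymm
  · intro v hv
    obtain ⟨f, hf, rfl⟩ := (hb.mem_iff v).mp hv
    obtain ⟨h, hh⟩ := ha.dvd_of_le hb hAB
    have hmon : h.Monic := hb.monic.of_mul_monic_left (hh ▸ ha.monic)
    have hhr : h.natDegree = r := by
      have := hb.monic.natDegree_mul hmon
      rw [← hh] at this
      omega
    have hsplit : f * b = (f /ₘ h) * a + (f %ₘ h) * b := by
      conv_lhs => rw [← modByMonic_add_div f h]
      rw [hh]; ring
    rw [hsplit, polyVec_add]
    apply Submodule.add_mem_sup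
    · refine (ha.mem_iff _).mpr ⟨_, ?_, rfl⟩
      by_cases h0 : f /ₘ h = 0
      · rw [h0, degree_zero]; exact WithBot.bot_lt_coe _
      · have hf0 : f ≠ 0 := by rintro rfl; simp at h0
        rw [degree_eq_natDegree hf0] at hf
        have hhf : h.natDegree ≤ f.natDegree := by
          by_contra! hlt
          exact h0 ((divByMonic_eq_zero_iff hmon).mpr (degree_lt_degree hlt))
        rw [degree_eq_natDegree h0, natDegree_divByMonic f hmon]
        norm_cast at hf ⊢
        omega
    · refine (mem_span_shiftR_polyVec_iff b (by omega) _).mpr ⟨_, ?_, rfl⟩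
      have := degree_modByMonic_lt f hmon
      rwa [degree_eq_natDegree hmon.ne_zero, hhr] at this
  · refine sup_le hAB fun v hv => ?_
    obtain ⟨f, hf, rfl⟩ := (mem_span_shiftR_polyVec_iff b (by omega) _).mp hv
    refine (hb.mem_iff _).mpr ⟨f, hf.trans_le ?_, rfl⟩
    exact_mod_cast (by omega : r ≤ n - b.natDegree)

lemma eq_zero_of_sum_smul_shiftR_mem (ha : IsGenPoly A a) (hb : IsGenPoly B b) {r : ℕ}
    (hr : r + b.natDegree = a.natDegree) (c : Fin r → F2)
    (hc : ∑ l, c l • shiftR (polyVec b : Vec n) ((l : ℕ) : ℤ) ∈ A) : c = 0 := by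
  have han := ha.natDegree_le
  rw [sum_smul_shiftR_polyVec b (by omega)] at hc
  obtain ⟨f, hf, hfa⟩ := (ha.mem_iff _).mp hc
  have hlow := hb.degree_mul_lt (mem_degreeLT.mp ((degreeLTEquiv F2 r).symm c).2)
  have hhigh := ha.degree_mul_lt hf
  rw [Nat.sub_add_cancel han] at hhigh
  rw [hr] at hlow
  have heq := polyVec_injective_of_degree_lt (hlow.trans_le (by exact_mod_cast han)) hhigh hfa
  have hzero : ((degreeLTEquiv F2 r).symm c : F2[X]) * b = 0 := by
    refine eq_zero_of_dvd_of_degree_lt (p := a) (heq ▸ dvd_mul_left _ _) ?_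
    rwa [degree_eq_natDegree ha.monic.ne_zero]
  have hsymm := (mul_eq_zero.mp hzero).resolve_right hb.monic.ne_zero
  simpa using hsymm

end IsGenPoly

section DotProduct

variable {ι : Type} [Fintype ι]

lemma dot_comm (u v : ι → F2) : dot u v = dot v u := dotProduct_comm u v

lemma dot_add_right (u v w : ι → F2) : dot u (v + w) = dot u v + dot u w := dotProduct_add u v w

lemma dot_add_left (u v w : ι → F2) : dot (u + v) w = dot u w + dot v w := add_dotProduct u v w

lemma dot_sum_smul_right {κ : Type} [Fintype κ] (u : ι → F2) (a : κ → F2) (v : κ → ι → F2) :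
    dot u (∑ i, a i • v i) = ∑ i, a i * dot u (v i) := by
  change u ⬝ᵥ _ = ∑ i, a i * (u ⬝ᵥ v i)
  simp [dotProduct_sum, dotProduct_smul]

lemma dualCode_anti {A B : Submodule F2 (ι → F2)} (h : A ≤ B) : dualCode B ≤ dualCode A :=
  fun _ hw c hc => hw c (h hc)

lemma mem_dualCode_span_range {κ : Type} {u : κ → ι → F2} {w : ι → F2}
    (h : ∀ k, dot (u k) w = 0) : w ∈ dualCode (Submodule.span F2 (Set.range u)) := by
  intro c hc
  have hle : Submodule.span F2 (Set.range u) ≤ dualCode (Submodule.span F2 {w}) := by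
    rw [Submodule.span_le]
    rintro _ ⟨k, rfl⟩ x hx
    obtain ⟨s, rfl⟩ := Submodule.mem_span_singleton.mp hx
    rw [dot_comm]
    exact (dotProduct_smul s (u k) w).trans (by rw [show u k ⬝ᵥ w = 0 from h k, smul_zero])
  rw [dot_comm]
  exact hle hc w (Submodule.mem_span_singleton_self w)

lemma inf_dualCode_le {A B : Submodule F2 (ι → F2)} :
    dualCode A ⊓ dualCode B ≤ dualCode (A ⊔ B) := by
  rintro w ⟨hA, hB⟩ c hc
  obtain ⟨x, hx, y, hy, rfl⟩ := Submodule.mem_sup.mp hc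
  rw [dot_add_left, hA x hx, hB y hy, add_zero]

/-- If the pairing between `u` and `v` is nondegenerate, the span of `v` has a family dual
to `u`. -/
lemma exists_dual_family {r : ℕ} (u v : Fin r → ι → F2)
    (h : ∀ a : Fin r → F2, (∀ j, dot (u j) (∑ i, a i • v i) = 0) → a = 0) :
    ∃ w : Fin r → ι → F2,
      Submodule.span F2 (Set.range w) = Submodule.span F2 (Set.range v) ∧
      (∀ i j, dot (u i) (w j) = if i = j then 1 else 0) ∧
      ∀ x ∈ Submodule.span F2 (Set.range v), x = ∑ j, dot (u j) x • w j := by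
  let G : Matrix (Fin r) (Fin r) F2 := Matrix.of fun j i => dot (u j) (v i)
  have hG : ∀ a, G.mulVec a = fun j => dot (u j) (∑ i, a i • v i) := by
    intro a
    ext j
    rw [dot_sum_smul_right]
    simp [G, Matrix.mulVec, dotProduct, mul_comm]
  have hsurj : Function.Surjective G.mulVecLin := by
    rw [← LinearMap.injective_iff_surjective, injective_iff_map_eq_zero]
    intro a ha
    refine h a fun j => ?_
    have := congrFun ha j
    rwa [Matrix.mulVecLin_apply, hG] at this
  choose a ha using fun j : Fin r => hsurj (Pi.single j 1)
  let w : Fin r → ι → F2 := fun j => ∑ i, a j i • v i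
  have hpair : ∀ i j, dot (u i) (w j) = if i = j then 1 else 0 := by
    intro i j
    have := congrFun (ha j) i
    rw [Matrix.mulVecLin_apply, hG] at this
    rw [Pi.single_apply] at this
    exact this
  have hwv : ∀ j, w j ∈ Submodule.span F2 (Set.range v) := fun j =>
    Submodule.sum_mem _ fun i _ => Submodule.smul_mem _ _ (Submodule.subset_span ⟨i, rfl⟩)
  have hexp : ∀ x ∈ Submodule.span F2 (Set.range v), x = ∑ j, dot (u j) x • w j := by
    intro x hx
    have hmem : x + ∑ j, dot (u j) x • w j ∈ Submodule.span F2 (Set.range v) :=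
      Submodule.add_mem _ hx (Submodule.sum_mem _ fun j _ => Submodule.smul_mem _ _ (hwv j))
    obtain ⟨c, hc⟩ := (Submodule.mem_span_range_iff_exists_fun F2).mp hmem
    have hc0 : c = 0 := by
      refine h c fun j => ?_
      rw [hc, dot_add_right, dot_sum_smul_right]
      simp [hpair, CharTwo.add_self_eq_zero]
    rw [hc0] at hc
    have hxz : x + ∑ j, dot (u j) x • w j = 0 := by simpa using hc.symm
    have hself : x = -x := funext fun i => (CharTwo.neg_eq (x i)).symm
    exact hself.trans (neg_eq_of_add_eq_zero_right hxz)
  refine ⟨w, le_antisymm ?_ ?_, hpair, hexp⟩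
  · rw [Submodule.span_le]
    rintro _ ⟨j, rfl⟩
    exact hwv j
  · intro x hx
    rw [hexp x hx]
    exact Submodule.sum_mem _ fun j _ => Submodule.smul_mem _ _ (Submodule.subset_span ⟨j, rfl⟩)

end DotProduct

lemma sup_span_range_add {R M κ : Type*} [Ring R] [AddCommGroup M] [Module R M]
    (A : Submodule R M) (v e : κ → M) (he : ∀ i, e i ∈ A) :
    A ⊔ Submodule.span R (Set.range fun i => v i + e i)
      = A ⊔ Submodule.span R (Set.range v) := by
  apply le_antisymm <;> refine sup_le le_sup_left (Submodule.span_le.mpr ?_)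
  · rintro _ ⟨i, rfl⟩
    exact Submodule.add_mem _ (Submodule.mem_sup_right (Submodule.subset_span ⟨i, rfl⟩))
      (Submodule.mem_sup_left (he i))
  · rintro _ ⟨i, rfl⟩
    rw [← add_sub_cancel_right (v i) (e i)]
    exact Submodule.sub_mem _ (Submodule.mem_sup_right (Submodule.subset_span ⟨i, rfl⟩))
      (Submodule.mem_sup_left (he i))

/-- Existence of the vectors `t̃_j, s^x_l, s^z_l, t^x_m, t^z_m`
with properties (1)–(8), where `q'_m = q_m + Σ_l (q_m·s^x_l) s^z_l`. -/
theorem stmt7 (n kc kd : ℕ) [NeZero n] (C D : Submodule F2 (Vec n))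
    (hCcyc : IsCyclicCode C) (hDcyc : IsCyclicCode D)
    (hdimC : Module.finrank F2 C = kc) (hdimD : Module.finrank F2 D = kd)
    (hCperp : dualCode C < C) (hCD : C < D) (hkckd : kc < kd)
    (p q pR qR : Polynomial F2)
    (hp : IsGenPoly C p) (hq : IsGenPoly D q)
    (hpR : IsGenPoly (dualCode C) pR) (hqR : IsGenPoly (dualCode D) qR)
    (hdegp : p.natDegree = n - kc) (hdegq : q.natDegree = n - kd)
    (hdegpR : pR.natDegree = kc) (hdegqR : qR.natDegree = kd)
    -- the named generating vectors of the paper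
    (pvec : Fin (2 * kc - n) → Vec n) (qvec : Fin (kd - kc) → Vec n)
    (ptil : Fin (kd - kc) → Vec n) (qtil : Fin (n - kd) → Vec n)
    (hpvec : ∀ l, pvec l = shiftR (polyVec p : Vec n) ((l : ℕ) : ℤ))
    (hqvec : ∀ m, qvec m = shiftR (polyVec q : Vec n) ((m : ℕ) : ℤ))
    (hptil : ∀ j, ptil j = shiftR (polyVec pR : Vec n) ((j : ℕ) : ℤ))
    (hqtil : ∀ i, qtil i = shiftR (polyVec qR : Vec n) ((i : ℕ) : ℤ)) :
    ∃ (ttil tx tz : Fin (kd - kc) → Vec n) (sx sz : Fin (2 * kc - n) → Vec n),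
      -- `q'_m` is well defined: the two expressions agree
      (∀ m, qvec m + ∑ l, dot (qvec m) (sx l) • sz l
          = qvec m + ∑ l, dot (qvec m) (sz l) • sx l) ∧
      -- (1) span identities
      (Submodule.span F2 (Set.range sx) = Submodule.span F2 (Set.range sz) ∧
       Submodule.span F2 (Set.range sx) = Submodule.span F2 (Set.range pvec) ∧
       Submodule.span F2 (Set.range ttil) = Submodule.span F2 (Set.range ptil) ∧
       Submodule.span F2 (Set.range ttil ∪ Set.range tx)
         = Submodule.span F2 (Set.range ttil ∪ Set.range tz) ∧
       Submodule.span F2 (Set.range ttil ∪ Set.range tx)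
         = Submodule.span F2 (Set.range ptil ∪
             Set.range (fun m => qvec m + ∑ l, dot (qvec m) (sx l) • sz l))) ∧
      -- (2) code identities
      (dualCode C = Submodule.span F2 (Set.range qtil ∪ Set.range ttil) ∧
       C = Submodule.span F2 (Set.range qtil ∪ Set.range ttil ∪ Set.range sx) ∧
       C = Submodule.span F2 (Set.range qtil ∪ Set.range ttil ∪ Set.range sz) ∧
       D = Submodule.span F2
            (Set.range qtil ∪ Set.range ttil ∪ Set.range sx ∪ Set.range tx) ∧
       D = Submodule.span F2
            (Set.range qtil ∪ Set.range ttil ∪ Set.range sz ∪ Set.range tz)) ∧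
      -- (3) `q̃_i` is orthogonal to everything
      ((∀ i i', dot (qtil i) (qtil i') = 0) ∧
       (∀ i j, dot (qtil i) (ttil j) = 0) ∧
       (∀ i l, dot (qtil i) (sx l) = 0) ∧
       (∀ i l, dot (qtil i) (sz l) = 0) ∧
       (∀ i m, dot (qtil i) (tx m) = 0) ∧
       (∀ i m, dot (qtil i) (tz m) = 0)) ∧
      -- (4)
      ((∀ j j', dot (ttil j) (ttil j') = 0) ∧
       (∀ j l, dot (ttil j) (sx l) = 0) ∧
       (∀ j l, dot (ttil j) (sz l) = 0)) ∧
      -- (5)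
      ((∀ l, dot (sx l) (sz l) = 1) ∧
       (∀ l l', l' ≠ l → dot (sx l) (sz l') = 0) ∧
       (∀ l l', l' ≠ l → dot (sz l) (sx l') = 0)) ∧
      -- (6)
      ((∀ j, dot (ttil j) (tx j) = 1) ∧
       (∀ j, dot (ttil j) (tz j) = 1) ∧
       (∀ j j', j' ≠ j → dot (ttil j) (tx j') = 0) ∧
       (∀ j j', j' ≠ j → dot (ttil j) (tz j') = 0)) ∧
      -- (7)
      ((∀ l j, dot (sx l) (tz j) = 0) ∧
       (∀ l j, dot (sz l) (tx j) = 0)) ∧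
      -- (8)
      (∀ j j', dot (tx j) (tz j') = 0) := by
  have hCC : dualCode C ≤ C := hCperp.le
  have hDC : dualCode D ≤ dualCode C := dualCode_anti hCD.le
  have hkdn : kd ≤ n := hdegqR ▸ hqR.natDegree_le
  have hkcn : n - kc ≤ kc := by
    have := hpR.natDegree_le_of_le hp hCC
    omega
  have hspanDperp := hqR.eq_span
  rw [hdegqR, ← funext hqtil] at hspanDperp
  have hspanCperp := hqR.eq_sup_span hpR hDC (r := kd - kc) (by omega)
  rw [← funext hptil, hspanDperp] at hspanCperp
  have hspanC := hpR.eq_sup_span hp hCC (r := 2 * kc - n) (by omega)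
  rw [← funext hpvec] at hspanC
  have hspanD := hp.eq_sup_span hq hCD.le (r := kd - kc) (by omega)
  rw [← funext hqvec] at hspanD
  have hindC := hpR.eq_zero_of_sum_smul_shiftR_mem hp (r := 2 * kc - n) (by omega)
  simp only [← hpvec] at hindC
  have hindD := hp.eq_zero_of_sum_smul_shiftR_mem hq (r := kd - kc) (by omega)
  simp only [← hqvec] at hindD
  have hqtil_mem : ∀ i, qtil i ∈ dualCode D := fun i =>
    hspanDperp ▸ Submodule.subset_span ⟨i, rfl⟩
  have hptil_mem : ∀ j, ptil j ∈ dualCode C := fun j =>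
    hspanCperp ▸ Submodule.mem_sup_right (Submodule.subset_span ⟨j, rfl⟩)
  have hpvec_span : Submodule.span F2 (Set.range pvec) ≤ C := by
    conv_rhs => rw [hspanC]
    exact le_sup_right
  have hqvec_mem : ∀ m, qvec m ∈ D := by
    intro m
    rw [hspanD]
    exact Submodule.mem_sup_right (Submodule.subset_span ⟨m, rfl⟩)
  have hqtil_dot : ∀ i, ∀ x ∈ D, dot (qtil i) x = 0 := fun i x hx => by
    rw [dot_comm]; exact hqtil_mem i x hx
  have hptil_dot : ∀ j, ∀ x ∈ C, dot (ptil j) x = 0 := fun j x hx => by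
    rw [dot_comm]; exact hptil_mem j x hx
  -- the form restricted to the span of `pvec` is nondegenerate
  obtain ⟨sz, hsz_span, hsz_pair, hsz_exp⟩ := exists_dual_family pvec pvec (by
    intro a ha
    apply hindC
    have hx : ∑ i, a i • pvec i ∈ Submodule.span F2 (Set.range pvec) :=
      (Submodule.mem_span_range_iff_exists_fun F2).mpr ⟨a, rfl⟩
    have hdual : ∑ i, a i • pvec i ∈ dualCode (dualCode C) :=
      fun w hw => by rw [dot_comm]; exact hw _ (hpvec_span hx)
    have hsup := inf_dualCode_le ⟨hdual, mem_dualCode_span_range ha⟩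
    rwa [← hspanC] at hsup)
  have hsz_span_le : Submodule.span F2 (Set.range sz) ≤ C := hsz_span ▸ hpvec_span
  have hpvec_C : ∀ l, pvec l ∈ C := fun l => hpvec_span (Submodule.subset_span ⟨l, rfl⟩)
  have hsz_C : ∀ l, sz l ∈ C := fun l => hsz_span_le (Submodule.subset_span ⟨l, rfl⟩)
  have hproj_C : ∀ x, ∑ l, dot x (pvec l) • sz l ∈ C := fun x =>
    Submodule.sum_mem _ fun l _ => Submodule.smul_mem _ _ (hsz_C l)
  have hproj : ∀ x, ∑ l, dot x (pvec l) • sz l = ∑ l, dot x (sz l) • pvec l := by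
    intro x
    have hdot : ∀ k, dot x (pvec k) = ∑ l, dot (pvec l) (pvec k) * dot x (sz l) := fun k => by
      conv_lhs => rw [hsz_exp (pvec k) (Submodule.subset_span ⟨k, rfl⟩)]
      rw [dot_sum_smul_right]
    have hpv : ∀ l, dot x (sz l) • pvec l
        = ∑ k, (dot (pvec l) (pvec k) * dot x (sz l)) • sz k := fun l => by
      conv_lhs => rw [hsz_exp (pvec l) (Submodule.subset_span ⟨l, rfl⟩)]
      rw [Finset.smul_sum]
      refine Finset.sum_congr rfl fun k _ => ?_
      rw [smul_smul, dot_comm (pvec k), mul_comm]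
    simp_rw [hpv]
    rw [Finset.sum_comm]
    refine Finset.sum_congr rfl fun k _ => ?_
    rw [hdot k, Finset.sum_smul]
  set q' : Fin (kd - kc) → Vec n := fun m => qvec m + ∑ l, dot (qvec m) (pvec l) • sz l with hq'
  have hq'_D : ∀ m, q' m ∈ D := fun m => Submodule.add_mem _ (hqvec_mem m) (hCD.le (hproj_C _))
  have hq'_span_D : Submodule.span F2 (Set.range q') ≤ D :=
    Submodule.span_le.mpr (by rintro _ ⟨m, rfl⟩; exact hq'_D m)
  have hpvec_q' : ∀ l m, dot (pvec l) (q' m) = 0 := fun l m => by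
    simp only [hq']
    rw [dot_add_right, dot_sum_smul_right]
    simp [hsz_pair, dot_comm (pvec l), CharTwo.add_self_eq_zero]
  have hq'_perp : ∀ x ∈ Submodule.span F2 (Set.range q'),
      x ∈ dualCode (Submodule.span F2 (Set.range pvec)) := by
    intro x hx
    refine mem_dualCode_span_range fun l => ?_
    have hl : pvec l ∈ dualCode (Submodule.span F2 (Set.range q')) :=
      mem_dualCode_span_range fun m => by rw [dot_comm]; exact hpvec_q' l m
    rw [dot_comm]
    exact hl x hx
  -- the pairing between `ptil` and `q'` is nondegenerate
  obtain ⟨tx, htx_span, htx_pair, -⟩ := exists_dual_family ptil q' (by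
    intro a ha
    apply hindD
    have hx : ∑ i, a i • q' i ∈ Submodule.span F2 (Set.range q') :=
      (Submodule.mem_span_range_iff_exists_fun F2).mpr ⟨a, rfl⟩
    have hdual : ∑ i, a i • q' i ∈ dualCode (dualCode D) :=
      fun w hw => by rw [dot_comm]; exact hw _ (hq'_span_D hx)
    rw [hspanDperp] at hdual
    have hsup := inf_dualCode_le ⟨hdual, mem_dualCode_span_range ha⟩
    rw [← hspanCperp] at hsup
    have hsup' := inf_dualCode_le ⟨hsup, hq'_perp _ hx⟩
    rw [← hspanC] at hsup'
    have hmem := hCC hsup'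
    simp only [hq', smul_add, Finset.sum_add_distrib] at hmem
    exact (Submodule.add_mem_iff_left _ (Submodule.sum_mem _ fun m _ =>
      Submodule.smul_mem _ _ (hproj_C (qvec m)))).mp hmem)
  have htx_mem : ∀ m, tx m ∈ Submodule.span F2 (Set.range q') := fun m =>
    htx_span ▸ Submodule.subset_span ⟨m, rfl⟩
  have htx_perp : ∀ m, ∀ x ∈ Submodule.span F2 (Set.range pvec), dot x (tx m) = 0 :=
    fun m => hq'_perp _ (htx_mem m)
  let e : Fin (kd - kc) → Vec n := fun m => ∑ j, dot (tx j) (tx m) • ptil j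
  let tz : Fin (kd - kc) → Vec n := fun m => tx m + e m
  have he : ∀ m, e m ∈ Submodule.span F2 (Set.range ptil) := fun m =>
    (Submodule.mem_span_range_iff_exists_fun F2).mpr ⟨_, rfl⟩
  have heC : ∀ m, e m ∈ dualCode C := fun m =>
    Submodule.sum_mem _ fun j _ => Submodule.smul_mem _ _ (hptil_mem j)
  have hsup_tz := sup_span_range_add (Submodule.span F2 (Set.range ptil)) tx e he
  have hsupC_tz := sup_span_range_add C tx e fun m => hCC (heC m)
  have hsupC_q' := sup_span_range_add C qvec _ fun m => hproj_C (qvec m)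
  have hspanD' : D = C ⊔ Submodule.span F2 (Set.range tx) := by
    rw [htx_span, hsupC_q']; exact hspanD
  have htz_pair : ∀ i j, dot (ptil i) (tz j) = if i = j then 1 else 0 := fun i j => by
    rw [dot_add_right, htx_pair, hptil_dot i _ (hCC (heC j)), add_zero]
  have htx_D : ∀ m, tx m ∈ D := fun m => hq'_span_D (htx_mem m)
  have htz_D : ∀ m, tz m ∈ D := fun m =>
    Submodule.add_mem _ (htx_D m) (hCD.le (hCC (heC m)))
  have hspanC_sx : C = Submodule.span F2 (Set.range qtil ∪ Set.range ptil ∪ Set.range pvec) := by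
    rw [Submodule.span_union, Submodule.span_union, ← hspanCperp, ← hspanC]
  have hspanC_sz : C = Submodule.span F2 (Set.range qtil ∪ Set.range ptil ∪ Set.range sz) := by
    rw [Submodule.span_union, Submodule.span_union, ← hspanCperp, hsz_span, ← hspanC]
  refine ⟨ptil, tx, tz, pvec, sz, fun m => by rw [hproj], ⟨hsz_span.symm, rfl, rfl, ?_, ?_⟩,
    ⟨?_, hspanC_sx, hspanC_sz, ?_, ?_⟩,
    ⟨fun i i' => hqtil_dot i _ (hCD.le (hCC (hDC (hqtil_mem i')))),
      fun i j => hqtil_dot i _ (hCD.le (hCC (hptil_mem j))),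
      fun i l => hqtil_dot i _ (hCD.le (hpvec_C l)),
      fun i l => hqtil_dot i _ (hCD.le (hsz_C l)),
      fun i m => hqtil_dot i _ (htx_D m), fun i m => hqtil_dot i _ (htz_D m)⟩,
    ⟨fun j j' => hptil_dot j _ (hCC (hptil_mem j')), fun j l => hptil_dot j _ (hpvec_C l),
      fun j l => hptil_dot j _ (hsz_C l)⟩,
    ⟨fun l => by simp [hsz_pair], fun l l' h => by simp [hsz_pair, h.symm],
      fun l l' h => by rw [dot_comm, hsz_pair, if_neg h]⟩,
    ⟨fun j => by simp [htx_pair], fun j => by simp [htz_pair],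
      fun j j' h => by simp [htx_pair, h.symm], fun j j' h => by simp [htz_pair, h.symm]⟩,
    ⟨fun l j => ?_, fun l j => ?_⟩, fun j j' => ?_⟩
  · rw [Submodule.span_union, Submodule.span_union]
    exact hsup_tz.symm
  · rw [Submodule.span_union, Submodule.span_union, htx_span]
  · rw [Submodule.span_union, ← hspanCperp]
  · rw [Submodule.span_union, ← hspanC_sx]
    exact hspanD'
  · rw [Submodule.span_union, ← hspanC_sz]
    exact hspanD'.trans hsupC_tz.symm
  · rw [dot_add_right, htx_perp j _ (Submodule.subset_span ⟨l, rfl⟩), heC j _ (hpvec_C l),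
      add_zero]
  · exact htx_perp j _ (hsz_span ▸ Submodule.subset_span ⟨l, rfl⟩)
  · rw [dot_add_right, dot_sum_smul_right]
    simp [dot_comm (tx j) (ptil _), htx_pair, CharTwo.add_self_eq_zero]
end

section
/- Let C^⊥ = span{p̃_j : 1 ≤ j ≤ n−k_c} be the dual of a binary cyclic code, and let v, w ∈ F₂ⁿ. For every integer α with −a_l ≤ α ≤ a_r, the F₂-linear span, inside F₂^N ⊕ F₂^N ⊕ F₂ (whose three components encode the X-part, Z-part, and sign bit of a Pauli operator), of the set G_α equals the span of G_0, where G_α consists of the vectors (L_α(p̃_j), 0, p̃_j·O(v,−α)) for j = 1,…,n−k_c, the vectors (0, M_α(p̃_j), p̃_j·O(w,−α)) for j = 1,…,n−k_c, and the vectors (0, r, 0) for r ∈ R. -/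
open Polynomial

/-- `L_α(c)`: the length-`N` vector `(last aₗ+α coords of c | c | first aᵣ−α coords of c)`;
uniformly, position `i` holds `c((i − (aₗ+α)) mod n)`. -/
def padL (al n ar : ℕ) (α : ℤ) (c : Vec n) : Fin (al + n + ar) → F2 :=
  fun i => c (((((i : ℕ) : ℤ) - ((al : ℤ) + α)) : ℤ) : ZMod n)

/-- `M_α(c)`: the length-`N` vector `(0^{aₗ+α} | c | 0^{aᵣ−α})`. -/
def padM (al n ar : ℕ) (α : ℤ) (c : Vec n) : Fin (al + n + ar) → F2 :=
  fun i => if (al : ℤ) + α ≤ ((i : ℕ) : ℤ) ∧ ((i : ℕ) : ℤ) < (al : ℤ) + α + n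
    then c (((((i : ℕ) : ℤ) - ((al : ℤ) + α)) : ℤ) : ZMod n) else 0

/-- The set `R` of ancilla stabilizer vectors (1-indexed in the paper):
`e_i + e_{n+i}` for `1 ≤ i ≤ aₗ` and `e_{aₗ+i} + e_{aₗ+n+i}` for `1 ≤ i ≤ aᵣ`. -/
def ancSet (al n ar : ℕ) : Set (Fin (al + n + ar) → F2) :=
  (Set.range fun i : Fin al => (fun k : Fin (al + n + ar) =>
      (if (k : ℕ) = (i : ℕ) then (1 : F2) else 0) +
      (if (k : ℕ) = n + (i : ℕ) then (1 : F2) else 0))) ∪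
  (Set.range fun i : Fin ar => (fun k : Fin (al + n + ar) =>
      (if (k : ℕ) = al + (i : ℕ) then (1 : F2) else 0) +
      (if (k : ℕ) = al + n + (i : ℕ) then (1 : F2) else 0)))

lemma shiftR_shiftR {n : ℕ} (c : Vec n) (α β : ℤ) :
    shiftR (shiftR c α) β = shiftR c (α + β) := by
  funext i
  simp only [shiftR]
  congr 1
  push_cast
  ring

lemma shiftR_zero {n : ℕ} (c : Vec n) : shiftR c 0 = c := by
  funext i
  simp [shiftR]

/-- Shifting one argument of the dot product is shifting the other one backwards. -/
lemma dot_shiftR {n : ℕ} [NeZero n] (c v : Vec n) (α : ℤ) :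
    dot c (shiftR v (-α)) = dot (shiftR c α) v := by
  simp only [dot, shiftR]
  refine Fintype.sum_equiv (Equiv.addRight (α : ZMod n)) _ _ fun i => ?_
  simp

lemma IsCyclicCode.shiftR_mem {n : ℕ} [NeZero n] {C : Submodule F2 (Vec n)}
    (hC : IsCyclicCode C) {c : Vec n} (hc : c ∈ C) (α : ℤ) : shiftR c α ∈ C := by
  have hnat : ∀ k : ℕ, shiftR c k ∈ C := by
    intro k
    induction k with
    | zero => simpa [shiftR_zero] using hc
    | succ k ih => simpa [shiftR_shiftR] using hC _ ih
  have hcast : shiftR c α = shiftR c ((α : ZMod n).val : ℤ) := by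
    funext i
    simp [shiftR]
  exact hcast ▸ hnat _

lemma shiftR_mem_dualCode {n : ℕ} [NeZero n] {C : Submodule F2 (Vec n)}
    (hC : IsCyclicCode C) {w : Vec n} (hw : w ∈ dualCode C) (α : ℤ) :
    shiftR w α ∈ dualCode C := by
  intro c hc
  have h := dot_shiftR c w (-α)
  rw [neg_neg] at h
  rw [h]
  exact hw _ (hC.shiftR_mem hc _)

/-- Multiplication by `X ^ i` is a cyclic shift as long as the degree stays below `n`. -/
lemma polyVec_X_pow_mul {n : ℕ} [NeZero n] (g : Polynomial F2) (i : ℕ)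
    (hi : i + g.natDegree < n) :
    (polyVec (X ^ i * g) : Vec n) = shiftR (polyVec g) i := by
  funext x
  simp only [polyVec, shiftR, coeff_X_pow_mul', Int.cast_natCast]
  have hin : ((i : ℕ) : ZMod n).val = i := ZMod.val_cast_of_lt (by omega)
  split_ifs with h
  · rw [ZMod.val_sub (by rwa [hin]), hin]
  · symm
    apply coeff_eq_zero_of_natDegree_lt
    have hx : x - (i : ZMod n) = ((x.val + n - i : ℕ) : ZMod n) := by
      rw [Nat.cast_sub (by omega)]
      simp
    rw [hx, ZMod.val_cast_of_lt (by omega)]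
    omega

/-- The shifts of the generator polynomial by less than `n - deg g` span the code. -/
lemma IsGenPoly.le_span {n : ℕ} [NeZero n] {D : Submodule F2 (Vec n)} {g : Polynomial F2}
    (hg : IsGenPoly D g) :
    D ≤ Submodule.span F2 {c | ∃ j : ℕ, 1 ≤ j ∧ j ≤ n - g.natDegree ∧
      c = shiftR (polyVec g) ((j : ℤ) - 1)} := by
  intro c hc
  obtain ⟨f, hf, rfl⟩ := (hg.mem_iff c).1 hc
  have hsum : (polyVec (f * g) : Vec n) =
      ∑ i ∈ Finset.range (n - g.natDegree), f.coeff i • polyVec (X ^ i * g) := by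
    conv_lhs => rw [f.as_sum_range' (n - g.natDegree + 1)
      ((natDegree_le_of_degree_le hf.le).trans_lt (Nat.lt_succ_self _))]
    rw [Finset.sum_range_succ, coeff_eq_zero_of_degree_lt hf]
    funext x
    simp [polyVec, Finset.sum_mul, ← C_mul_X_pow_eq_monomial, mul_assoc]
  rw [hsum]
  refine Submodule.sum_mem _ fun i hi => Submodule.smul_mem _ _ (Submodule.subset_span ?_)
  have hi' := Finset.mem_range.1 hi
  refine ⟨i + 1, by omega, by omega, ?_⟩
  rw [polyVec_X_pow_mul g i (by omega)]
  simp

/-- The generators `p̃_j` belong to the code. -/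
lemma IsGenPoly.shiftR_mem {n : ℕ} [NeZero n] {D : Submodule F2 (Vec n)} {g : Polynomial F2}
    (hg : IsGenPoly D g) {j : ℕ} (hj : 1 ≤ j) (hjn : j ≤ n - g.natDegree) :
    shiftR (polyVec g) ((j : ℤ) - 1) ∈ D := by
  refine (hg.mem_iff _).2 ⟨X ^ (j - 1), ?_, ?_⟩
  · rw [degree_X_pow]
    exact_mod_cast (by omega : j - 1 < n - g.natDegree)
  · rw [polyVec_X_pow_mul g (j - 1) (by omega), Nat.cast_sub hj, Nat.cast_one]

lemma padL_eq_padL_shiftR (al n ar : ℕ) (α β : ℤ) (c : Vec n) :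
    padL al n ar α c = padL al n ar β (shiftR c (α - β)) := by
  funext i
  simp only [padL, shiftR]
  congr 1
  push_cast
  ring

/-- Indicator vector of the position `a`, zero if `a` is out of range. -/
def unitAt (N : ℕ) (a : ℤ) : Fin N → F2 := fun k => if ((k : ℕ) : ℤ) = a then 1 else 0

lemma padM_eq_sum (al n ar : ℕ) [NeZero n] (α : ℤ) (c : Vec n) :
    padM al n ar α c = ∑ x : ZMod n, c x • unitAt (al + n + ar) (al + α + x.val) := by
  funext i
  simp only [padM, unitAt, Finset.sum_apply, Pi.smul_apply, smul_eq_mul]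
  split_ifs with h
  · have hval : (((((i : ℕ) : ℤ) - (al + α) : ℤ) : ZMod n).val : ℤ) = (i : ℕ) - (al + α) := by
      rw [ZMod.val_intCast, Int.emod_eq_of_lt (by omega) (by omega)]
    rw [Finset.sum_eq_single ((((i : ℕ) : ℤ) - (al + α) : ℤ) : ZMod n)]
    · rw [hval, if_pos (by ring), mul_one]
    · intro x _ hx
      rw [if_neg, mul_zero]
      intro hix
      apply hx
      have : ((i : ℕ) : ℤ) - (al + α) = (x.val : ℤ) := by omega
      rw [this]
      simp
    · simp
  · symm
    refine Finset.sum_eq_zero fun x _ => ?_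
    have := ZMod.val_lt x
    rw [if_neg (by omega), mul_zero]

lemma unitAt_add_period_mem (al n ar a : ℕ) (ha : a < al + ar) :
    unitAt (al + n + ar) a - unitAt (al + n + ar) ((a + n : ℕ) : ℤ) ∈
      Submodule.span F2 (ancSet al n ar) := by
  rw [ZModModule.sub_eq_add]
  apply Submodule.subset_span
  by_cases h : a < al
  · refine Or.inl ⟨⟨a, h⟩, ?_⟩
    funext k
    simp only [unitAt, Pi.add_apply, Nat.cast_inj, Nat.add_comm a n]
  · refine Or.inr ⟨⟨a - al, by omega⟩, ?_⟩
    funext k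
    have h1 : al + (a - al) = a := by omega
    have h2 : al + n + (a - al) = a + n := by omega
    simp only [unitAt, Pi.add_apply, Nat.cast_inj, h1, h2]

lemma unitAt_sub_mem_of_le (al n ar a t : ℕ) (h : a + n * t < al + n + ar) :
    unitAt (al + n + ar) a - unitAt (al + n + ar) ((a + n * t : ℕ) : ℤ) ∈
      Submodule.span F2 (ancSet al n ar) := by
  induction t with
  | zero => simp
  | succ t ih =>
    rw [Nat.mul_succ, ← Nat.add_assoc] at h ⊢
    have := add_mem (ih (by omega)) (unitAt_add_period_mem al n ar (a + n * t) (by omega))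
    rwa [sub_add_sub_cancel] at this

/-- Modulo the ancilla vectors, a unit vector depends only on its position mod `n`. -/
lemma unitAt_sub_mem (al n ar : ℕ) {a b : ℤ} (ha : 0 ≤ a) (haN : a < al + n + ar)
    (hb : 0 ≤ b) (hbN : b < al + n + ar) (hab : (a : ZMod n) = b) :
    unitAt (al + n + ar) a - unitAt (al + n + ar) b ∈ Submodule.span F2 (ancSet al n ar) := by
  wlog hle : a ≤ b generalizing a b
  · rw [← neg_sub]
    exact neg_mem (this hb hbN ha haN hab.symm (by omega))
  lift a to ℕ using ha
  lift b to ℕ using hb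
  have hmod : a ≡ b [MOD n] := (ZMod.natCast_eq_natCast_iff a b n).1 (by exact_mod_cast hab)
  obtain ⟨t, ht⟩ := (Nat.modEq_iff_dvd' (by omega)).1 hmod
  obtain rfl : b = a + n * t := by omega
  exact unitAt_sub_mem_of_le al n ar a t (by omega)

/-- Modulo the ancilla vectors, changing the offset of `padM` amounts to a cyclic shift. -/
lemma padM_sub_padM_shiftR_mem (al n ar : ℕ) [NeZero n] {α β : ℤ}
    (hα₁ : -(al : ℤ) ≤ α) (hα₂ : α ≤ ar) (hβ₁ : -(al : ℤ) ≤ β) (hβ₂ : β ≤ ar) (c : Vec n) :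
    padM al n ar α c - padM al n ar β (shiftR c (α - β)) ∈
      Submodule.span F2 (ancSet al n ar) := by
  have hre : padM al n ar β (shiftR c (α - β)) = ∑ x : ZMod n,
      c x • unitAt (al + n + ar) (al + β + (x + ((α - β : ℤ) : ZMod n)).val) := by
    rw [padM_eq_sum]
    symm
    refine Fintype.sum_equiv (Equiv.addRight ((α - β : ℤ) : ZMod n)) _ _ fun x => ?_
    simp [shiftR]
  rw [hre, padM_eq_sum, ← Finset.sum_sub_distrib]
  refine Submodule.sum_mem _ fun x _ => ?_
  rw [← smul_sub]
  have h1 := ZMod.val_lt x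
  have h2 := ZMod.val_lt (x + ((α - β : ℤ) : ZMod n))
  refine Submodule.smul_mem _ _
    (unitAt_sub_mem al n ar (by omega) (by omega) (by omega) (by omega) ?_)
  push_cast
  simp only [ZMod.natCast_zmod_val]
  ring

/-- The map `c ↦ (L_α(c), 0, c·O(v,-α))`. -/
def genX (al n ar : ℕ) [NeZero n] (α : ℤ) (v : Vec n) :
    Vec n →ₗ[F2] (Fin (al + n + ar) → F2) × (Fin (al + n + ar) → F2) × F2 where
  toFun c := (padL al n ar α c, 0, dot c (shiftR v (-α)))
  map_add' c d := by
    ext i <;> simp [padL, dot, add_mul, Finset.sum_add_distrib]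
  map_smul' r c := by
    ext i <;> simp [padL, dot, mul_assoc, Finset.mul_sum]

/-- The map `c ↦ (0, M_α(c), c·O(w,-α))`. -/
def genZ (al n ar : ℕ) [NeZero n] (α : ℤ) (w : Vec n) :
    Vec n →ₗ[F2] (Fin (al + n + ar) → F2) × (Fin (al + n + ar) → F2) × F2 where
  toFun c := (0, padM al n ar α c, dot c (shiftR w (-α)))
  map_add' c d := by
    ext i
    · simp
    · simp only [padM, Prod.snd_add, Prod.fst_add, Pi.add_apply]
      split_ifs <;> simp
    · simp [dot, add_mul, Finset.sum_add_distrib]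
  map_smul' r c := by
    ext i
    · simp
    · simp [padM]
    · simp [dot, mul_assoc, Finset.mul_sum]

/-- The embedding `r ↦ (0, r, 0)`. -/
def embZ (N : ℕ) : (Fin N → F2) →ₗ[F2] (Fin N → F2) × (Fin N → F2) × F2 :=
  LinearMap.inr F2 _ _ ∘ₗ LinearMap.inl F2 _ _

/-- The span of `G_α`, in terms of the whole code. -/
def padSpan (al n ar : ℕ) [NeZero n] (D : Submodule F2 (Vec n)) (v w : Vec n) (α : ℤ) :
    Submodule F2 ((Fin (al + n + ar) → F2) × (Fin (al + n + ar) → F2) × F2) :=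
  D.map (genX al n ar α v) ⊔ D.map (genZ al n ar α w) ⊔
    (Submodule.span F2 (ancSet al n ar)).map (embZ (al + n + ar))

lemma padSpan_le (al n ar : ℕ) [NeZero n] {D : Submodule F2 (Vec n)}
    (hD : ∀ c ∈ D, ∀ m : ℤ, shiftR c m ∈ D) (v w : Vec n) {α β : ℤ}
    (hα₁ : -(al : ℤ) ≤ α) (hα₂ : α ≤ ar) (hβ₁ : -(al : ℤ) ≤ β) (hβ₂ : β ≤ ar) :
    padSpan al n ar D v w α ≤ padSpan al n ar D v w β := by
  have hdot : ∀ c u : Vec n, dot c (shiftR u (-α)) = dot (shiftR c (α - β)) (shiftR u (-β)) := by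
    intro c u
    rw [dot_shiftR, dot_shiftR, shiftR_shiftR, sub_add_cancel]
  refine sup_le (sup_le ?_ ?_) le_sup_right
  · rintro _ ⟨c, hc, rfl⟩
    refine Submodule.mem_sup_left (Submodule.mem_sup_left ⟨_, hD c hc (α - β), ?_⟩)
    simp only [genX, LinearMap.coe_mk, AddHom.coe_mk]
    rw [hdot, padL_eq_padL_shiftR al n ar α β]
  · rintro _ ⟨c, hc, rfl⟩
    have hsplit : genZ al n ar α w c = genZ al n ar β w (shiftR c (α - β)) +
        embZ (al + n + ar) (padM al n ar α c - padM al n ar β (shiftR c (α - β))) := by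
      simp [genZ, embZ, hdot]
    rw [hsplit]
    exact add_mem
      (Submodule.mem_sup_left (Submodule.mem_sup_right ⟨_, hD c hc _, rfl⟩))
      (Submodule.mem_sup_right
        ⟨_, padM_sub_padM_shiftR_mem al n ar hα₁ hα₂ hβ₁ hβ₂ c, rfl⟩)

lemma IsGenPoly.span_eq {n : ℕ} [NeZero n] {D : Submodule F2 (Vec n)} {g : Polynomial F2}
    (hg : IsGenPoly D g) :
    Submodule.span F2 {c | ∃ j : ℕ, 1 ≤ j ∧ j ≤ n - g.natDegree ∧
      c = shiftR (polyVec g) ((j : ℤ) - 1)} = D := by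
  refine le_antisymm (Submodule.span_le.2 ?_) hg.le_span
  rintro _ ⟨j, hj, hjn, rfl⟩
  exact hg.shiftR_mem hj hjn

lemma IsGenPoly.span_eq_padSpan {n : ℕ} [NeZero n] {D : Submodule F2 (Vec n)}
    {g : Polynomial F2} (hg : IsGenPoly D g) (al ar : ℕ) (v w : Vec n) (α : ℤ) :
    Submodule.span F2
      (({ x : (Fin (al + n + ar) → F2) × (Fin (al + n + ar) → F2) × F2 |
          ∃ j : ℕ, 1 ≤ j ∧ j ≤ n - g.natDegree ∧
            x = (padL al n ar α (shiftR (polyVec g : Vec n) ((j : ℤ) - 1)), 0,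
                 dot (shiftR (polyVec g : Vec n) ((j : ℤ) - 1)) (shiftR v (-α))) } ∪
        { x : (Fin (al + n + ar) → F2) × (Fin (al + n + ar) → F2) × F2 |
          ∃ j : ℕ, 1 ≤ j ∧ j ≤ n - g.natDegree ∧
            x = (0, padM al n ar α (shiftR (polyVec g : Vec n) ((j : ℤ) - 1)),
                 dot (shiftR (polyVec g : Vec n) ((j : ℤ) - 1)) (shiftR w (-α))) } ∪
        { x : (Fin (al + n + ar) → F2) × (Fin (al + n + ar) → F2) × F2 |
          ∃ r ∈ ancSet al n ar, x = (0, r, 0) })) = padSpan al n ar D v w α := by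
  rw [Submodule.span_union, Submodule.span_union, padSpan]
  conv_rhs => rw [← hg.span_eq]
  simp only [Submodule.map_span]
  congr 3
  · ext x
    constructor
    · rintro ⟨j, hj, hjn, rfl⟩
      exact ⟨_, ⟨j, hj, hjn, rfl⟩, rfl⟩
    · rintro ⟨_, ⟨j, hj, hjn, rfl⟩, rfl⟩
      exact ⟨j, hj, hjn, rfl⟩
  · ext x
    constructor
    · rintro ⟨j, hj, hjn, rfl⟩
      exact ⟨_, ⟨j, hj, hjn, rfl⟩, rfl⟩
    · rintro ⟨_, ⟨j, hj, hjn, rfl⟩, rfl⟩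
      exact ⟨j, hj, hjn, rfl⟩
  · ext x
    constructor
    · rintro ⟨r, hr, rfl⟩
      exact ⟨r, hr, rfl⟩
    · rintro ⟨r, hr, rfl⟩
      exact ⟨r, hr, rfl⟩

/-- (Theorem `sync_proof_subspace`.) For every `α ∈ [−aₗ, aᵣ]`, the
span of the generating set `G_α` of the padded stabilizer group (X-part, Z-part, sign
bit) equals the span of `G_0`. -/
theorem stmt8 (n kc : ℕ) [NeZero n] (C : Submodule F2 (Vec n))
    (hCcyc : IsCyclicCode C) (hdimC : Module.finrank F2 C = kc)
    (pR : Polynomial F2) (hpR : IsGenPoly (dualCode C) pR) (hdegpR : pR.natDegree = kc)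
    (al ar : ℕ) (v w : Vec n)
    (α : ℤ) (hα₁ : -(al : ℤ) ≤ α) (hα₂ : α ≤ (ar : ℤ)) :
    Submodule.span F2
      (({ x : (Fin (al + n + ar) → F2) × (Fin (al + n + ar) → F2) × F2 |
          ∃ j : ℕ, 1 ≤ j ∧ j ≤ n - kc ∧
            x = (padL al n ar α (shiftR (polyVec pR : Vec n) ((j : ℤ) - 1)), 0,
                 dot (shiftR (polyVec pR : Vec n) ((j : ℤ) - 1)) (shiftR v (-α))) } ∪
        { x : (Fin (al + n + ar) → F2) × (Fin (al + n + ar) → F2) × F2 |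
          ∃ j : ℕ, 1 ≤ j ∧ j ≤ n - kc ∧
            x = (0, padM al n ar α (shiftR (polyVec pR : Vec n) ((j : ℤ) - 1)),
                 dot (shiftR (polyVec pR : Vec n) ((j : ℤ) - 1)) (shiftR w (-α))) } ∪
        { x : (Fin (al + n + ar) → F2) × (Fin (al + n + ar) → F2) × F2 |
          ∃ r ∈ ancSet al n ar, x = (0, r, 0) }))
    = Submodule.span F2
      (({ x : (Fin (al + n + ar) → F2) × (Fin (al + n + ar) → F2) × F2 |
          ∃ j : ℕ, 1 ≤ j ∧ j ≤ n - kc ∧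
            x = (padL al n ar 0 (shiftR (polyVec pR : Vec n) ((j : ℤ) - 1)), 0,
                 dot (shiftR (polyVec pR : Vec n) ((j : ℤ) - 1)) v) } ∪
        { x : (Fin (al + n + ar) → F2) × (Fin (al + n + ar) → F2) × F2 |
          ∃ j : ℕ, 1 ≤ j ∧ j ≤ n - kc ∧
            x = (0, padM al n ar 0 (shiftR (polyVec pR : Vec n) ((j : ℤ) - 1)),
                 dot (shiftR (polyVec pR : Vec n) ((j : ℤ) - 1)) w) } ∪
        { x : (Fin (al + n + ar) → F2) × (Fin (al + n + ar) → F2) × F2 |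
          ∃ r ∈ ancSet al n ar, x = (0, r, 0) })) := by
  subst hdegpR
  have h0 := hpR.span_eq_padSpan al ar v w 0
  rw [neg_zero, shiftR_zero, shiftR_zero] at h0
  rw [hpR.span_eq_padSpan, h0]
  have hD : ∀ c ∈ dualCode C, ∀ m : ℤ, shiftR c m ∈ dualCode C :=
    fun _ hc m => shiftR_mem_dualCode hCcyc hc m
  exact le_antisymm
    (padSpan_le al n ar hD v w hα₁ hα₂ (by omega) (by omega))
    (padSpan_le al n ar hD v w (by omega) (by omega) hα₁ hα₂)
end
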